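/- arXiv:1805.12529 — 2 statements merged into one kernel-verified Lean document; each statement's English description precedes it below -/
import Mathlib

section
/- Assume the generative model where in addition Z* has full row rank, and assume q := κ(Z*)^4 · max_{1≤k≤n} ‖D_k Z* D̃_k‖_2 < 1. Then for every q̄ ∈ (q, 1) there exists ε > 0 such that whenever an initial matrix W^0 satisfies ‖W^0 − W*‖_F ≤ ε, the single alternating-algorithm step producing Z^1 (columns Z^1_{(·,j)} = H_s(W^0 P_{(·,j)})) and W^1 (an orthogonal minimizer of ‖W P − Z^1‖_F over orthogonal W) satisfies ‖W^1 − W*‖_F ≤ q̄ ‖W^0 − W*‖_F. -/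
open Matrix MeasureTheory ProbabilityTheory Filter
open scoped Kronecker

noncomputable section

/-- Frobenius norm of a real matrix. -/
def frobNorm {m n : Type*} [Fintype m] [Fintype n] (M : Matrix m n ℝ) : ℝ :=
  Real.sqrt (∑ i, ∑ j, (M i j) ^ 2)

/-- Spectral norm (largest singular value) of a real matrix. -/
def specNorm {m n : Type*} [Fintype m] [Fintype n] [DecidableEq n] (M : Matrix m n ℝ) : ℝ :=
  ‖LinearMap.toContinuousLinearMap (Matrix.toEuclideanLin M)‖

/-- Smallest singular value of a real matrix (as the infimum of `‖Mᵀ x‖` over unit vectors). -/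
def sigmaMin {m n : Type*} [Fintype m] [Fintype n] [DecidableEq m] (M : Matrix m n ℝ) : ℝ :=
  sInf {c : ℝ | ∃ x : EuclideanSpace ℝ m, ‖x‖ = 1 ∧ c = ‖Matrix.toEuclideanLin Mᵀ x‖}

/-- Condition number: ratio of largest to smallest singular value. -/
def condNum {m n : Type*} [Fintype m] [Fintype n] [DecidableEq m] [DecidableEq n]
    (M : Matrix m n ℝ) : ℝ :=
  specNorm M / sigmaMin M

/-- `D_k`: diagonal matrix with ones on the diagonal except a zero at `(k,k)`. -/
def Dk {n : Type*} [Fintype n] [DecidableEq n] (k : n) : Matrix n n ℝ :=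
  Matrix.diagonal (fun i => if i = k then 0 else 1)

/-- `D̃_k`: diagonal matrix with ones at columns in the support of the `k`-th row of `Z`. -/
def Dtil {n N : Type*} [Fintype n] [Fintype N] [DecidableEq N]
    (Z : Matrix n N ℝ) (k : n) : Matrix N N ℝ :=
  Matrix.diagonal (fun j => if Z k j ≠ 0 then 1 else 0)

/-- `max_{1 ≤ k ≤ n} ‖D_k Z D̃_k‖₂`. -/
def qmax {n N : Type*} [Fintype n] [Fintype N] [DecidableEq n] [DecidableEq N]
    (Z : Matrix n N ℝ) : ℝ :=
  ⨆ k : n, specNorm (Dk k * Z * Dtil Z k)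

/-- `z = H_s(v)`: hard thresholding of `v` to its `s` largest-magnitude entries. -/
def IsHardThresh {n : ℕ} (s : ℕ) (v z : Fin n → ℝ) : Prop :=
  ∃ T : Finset (Fin n), T.card = s ∧ (∀ i ∈ T, ∀ j ∉ T, |v j| ≤ |v i|) ∧
    (∀ i ∈ T, z i = v i) ∧ (∀ i ∉ T, z i = 0)

/-- Euclidean norm of a vector. -/
def l2norm {n : ℕ} (v : Fin n → ℝ) : ℝ := Real.sqrt (∑ i, (v i) ^ 2)

/-- `β(v)`: smallest magnitude among the nonzero entries of `v`. -/
def betaMin {n : ℕ} (v : Fin n → ℝ) : ℝ :=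
  sInf {c : ℝ | ∃ i, v i ≠ 0 ∧ c = |v i|}

/-- The constant `C(ε₀)` from the convergence-radius analysis. -/
def Cconst (e : ℝ) : ℝ :=
  2 + 9 * Real.sqrt 2 / (8 * (1 - 2 * e - e ^ 2) ^ ((3 : ℝ) / 2)) + Real.sqrt 2 / (1 - e)

end

section FrobeniusNorm

variable {m n p : Type*} [Fintype m] [Fintype n] [Fintype p]

lemma frobNorm_nonneg (M : Matrix m n ℝ) : 0 ≤ frobNorm M := Real.sqrt_nonneg _

lemma frobNorm_sq (M : Matrix m n ℝ) : frobNorm M ^ 2 = ∑ i, ∑ j, M i j ^ 2 :=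
  Real.sq_sqrt (Finset.sum_nonneg fun _ _ => Finset.sum_nonneg fun _ _ => sq_nonneg _)

lemma frobNorm_sq_eq_trace (M : Matrix m n ℝ) : frobNorm M ^ 2 = (Mᵀ * M).trace := by
  rw [frobNorm_sq, Finset.sum_comm]
  simp [Matrix.trace, Matrix.mul_apply, sq]

lemma frobNorm_transpose (M : Matrix m n ℝ) : frobNorm Mᵀ = frobNorm M := by
  rw [frobNorm, frobNorm, Finset.sum_comm]
  rfl

lemma trace_transpose_mul_le (X Y : Matrix m n ℝ) :
    (Xᵀ * Y).trace ≤ frobNorm X * frobNorm Y := by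
  have h := Real.sum_mul_le_sqrt_mul_sqrt (Finset.univ : Finset (m × n))
    (fun x => X x.1 x.2) (fun x => Y x.1 x.2)
  simp only [Fintype.sum_prod_type] at h
  refine le_trans (le_of_eq ?_) h
  rw [Finset.sum_comm]
  simp [Matrix.trace, Matrix.mul_apply]

open scoped Matrix.Norms.Frobenius in
lemma frobNorm_eq_norm (M : Matrix m n ℝ) : frobNorm M = ‖M‖ := by
  rw [Matrix.frobenius_norm_def, frobNorm, Real.sqrt_eq_rpow]
  simp

lemma frobNorm_add_le (X Y : Matrix m n ℝ) : frobNorm (X + Y) ≤ frobNorm X + frobNorm Y := by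
  open scoped Matrix.Norms.Frobenius in
  simpa only [frobNorm_eq_norm] using norm_add_le X Y

lemma frobNorm_sub_le (X Y : Matrix m n ℝ) : frobNorm (X - Y) ≤ frobNorm X + frobNorm Y := by
  open scoped Matrix.Norms.Frobenius in
  simpa only [frobNorm_eq_norm] using norm_sub_le X Y

lemma frobNorm_sub_comm (X Y : Matrix m n ℝ) : frobNorm (X - Y) = frobNorm (Y - X) := by
  open scoped Matrix.Norms.Frobenius in
  simpa only [frobNorm_eq_norm] using norm_sub_rev X Y

lemma frobNorm_mul_le (X : Matrix m n ℝ) (Y : Matrix n p ℝ) :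
    frobNorm (X * Y) ≤ frobNorm X * frobNorm Y := by
  open scoped Matrix.Norms.Frobenius in
  simpa only [frobNorm_eq_norm] using Matrix.frobenius_norm_mul X Y

lemma frobNorm_orthogonal_mul [DecidableEq n] {U : Matrix m n ℝ} (hU : Uᵀ * U = 1)
    (M : Matrix n p ℝ) : frobNorm (U * M) = frobNorm M := by
  rw [← sq_eq_sq₀ (frobNorm_nonneg _) (frobNorm_nonneg _), frobNorm_sq_eq_trace,
    frobNorm_sq_eq_trace, Matrix.transpose_mul, Matrix.mul_assoc, ← Matrix.mul_assoc Uᵀ, hU,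
    Matrix.one_mul]

lemma abs_apply_le_frobNorm (M : Matrix m n ℝ) (i : m) (j : n) : |M i j| ≤ frobNorm M := by
  apply Real.abs_le_sqrt
  calc M i j ^ 2 ≤ ∑ j, M i j ^ 2 :=
        Finset.single_le_sum (f := fun j => M i j ^ 2) (fun _ _ => sq_nonneg _) (Finset.mem_univ j)
    _ ≤ _ := Finset.single_le_sum (f := fun i => ∑ j, M i j ^ 2)
        (fun _ _ => Finset.sum_nonneg fun _ _ => sq_nonneg _) (Finset.mem_univ i)

lemma frobNorm_sub_sq_of_orthogonal [DecidableEq n] {U : Matrix n n ℝ} (hU : Uᵀ * U = 1)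
    (X Y : Matrix n p ℝ) :
    frobNorm (U * X - Y) ^ 2 = frobNorm X ^ 2 + frobNorm Y ^ 2 - 2 * (U * X * Yᵀ).trace := by
  have h₁ : ((U * X)ᵀ * Y).trace = (U * X * Yᵀ).trace := by
    rw [← Matrix.trace_transpose, Matrix.transpose_mul, Matrix.transpose_transpose,
      Matrix.trace_mul_comm]
  have h₂ : (Yᵀ * (U * X)).trace = (U * X * Yᵀ).trace := Matrix.trace_mul_comm _ _
  rw [← frobNorm_orthogonal_mul hU X]
  simp only [frobNorm_sq_eq_trace, Matrix.transpose_sub, Matrix.sub_mul, Matrix.mul_sub,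
    Matrix.trace_sub, h₁, h₂]
  ring

end FrobeniusNorm

section SpectralNorm

variable {m n p : Type*} [Fintype m] [Fintype n] [Fintype p]

lemma specNorm_nonneg [DecidableEq n] (M : Matrix m n ℝ) : 0 ≤ specNorm M := norm_nonneg _

lemma toEuclideanLin_norm_sq [DecidableEq n] (M : Matrix m n ℝ) (x : EuclideanSpace ℝ n) :
    ‖Matrix.toEuclideanLin M x‖ ^ 2 = ∑ i, (M *ᵥ x.ofLp) i ^ 2 := by
  rw [EuclideanSpace.real_norm_sq_eq]
  rfl

lemma sum_mulVec_sq_le [DecidableEq n] (M : Matrix m n ℝ) (v : n → ℝ) :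
    ∑ i, (M *ᵥ v) i ^ 2 ≤ specNorm M ^ 2 * ∑ j, v j ^ 2 := by
  have h := (LinearMap.toContinuousLinearMap (Matrix.toEuclideanLin M)).le_opNorm (WithLp.toLp 2 v)
  have h₁ := pow_le_pow_left₀ (norm_nonneg _) h 2
  rw [mul_pow] at h₁
  simp only [LinearMap.coe_toContinuousLinearMap', toEuclideanLin_norm_sq] at h₁
  rw [EuclideanSpace.real_norm_sq_eq] at h₁
  exact h₁

lemma specNorm_eq_of_orthogonal_mul [DecidableEq m] [DecidableEq n] {U : Matrix m m ℝ}
    (hU : Uᵀ * U = 1) (M : Matrix m n ℝ) : specNorm (U * M) = specNorm M := by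
  open scoped Matrix.Norms.L2Operator in
  have key (X : Matrix m n ℝ) : specNorm X * specNorm X = ‖Xᵀ * X‖ :=
    (Matrix.l2_opNorm_conjTranspose_mul_self X).symm
  rw [← mul_self_inj (specNorm_nonneg _) (specNorm_nonneg _), key, key, Matrix.transpose_mul,
    Matrix.mul_assoc, ← Matrix.mul_assoc Uᵀ, hU, Matrix.one_mul]

lemma specNorm_transpose [DecidableEq m] [DecidableEq n] (M : Matrix m n ℝ) :
    specNorm Mᵀ = specNorm M := by
  open scoped Matrix.Norms.L2Operator in
  exact Matrix.l2_opNorm_conjTranspose M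

lemma frobNorm_mul_le_specNorm [DecidableEq n] [DecidableEq p] (X : Matrix m n ℝ)
    (Y : Matrix n p ℝ) : frobNorm (X * Y) ≤ specNorm Y * frobNorm X := by
  refine (pow_le_pow_iff_left₀ (frobNorm_nonneg _)
    (mul_nonneg (specNorm_nonneg _) (frobNorm_nonneg _)) two_ne_zero).1 ?_
  rw [mul_pow, frobNorm_sq, frobNorm_sq, Finset.mul_sum]
  refine Finset.sum_le_sum fun i _ => ?_
  have h := sum_mulVec_sq_le Yᵀ (X i)
  rw [specNorm_transpose, Matrix.mulVec_transpose] at h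
  exact h

lemma sigmaMin_nonneg [DecidableEq m] (M : Matrix m n ℝ) : 0 ≤ sigmaMin M := by
  apply Real.sInf_nonneg
  rintro _ ⟨x, -, rfl⟩
  exact norm_nonneg _

lemma sigmaMin_mul_norm_le [DecidableEq m] (M : Matrix m n ℝ) (x : EuclideanSpace ℝ m) :
    sigmaMin M * ‖x‖ ≤ ‖Matrix.toEuclideanLin Mᵀ x‖ := by
  rcases eq_or_ne x 0 with rfl | hx
  · simp
  have hx' : 0 < ‖x‖ := norm_pos_iff.2 hx
  have h : sigmaMin M ≤ ‖Matrix.toEuclideanLin Mᵀ (‖x‖⁻¹ • x)‖ := by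
    refine csInf_le ⟨0, ?_⟩ ⟨_, ?_, rfl⟩
    · rintro _ ⟨x, -, rfl⟩
      exact norm_nonneg _
    · rw [norm_smul, norm_inv, norm_norm, inv_mul_cancel₀ hx'.ne']
  rw [map_smul, norm_smul, norm_inv, norm_norm, inv_mul_eq_div, le_div_iff₀ hx'] at h
  exact h

lemma sigmaMin_mul_frobNorm_le [DecidableEq n] (X : Matrix m n ℝ) (M : Matrix n p ℝ) :
    sigmaMin M * frobNorm X ≤ frobNorm (X * M) := by
  refine (pow_le_pow_iff_left₀ (mul_nonneg (sigmaMin_nonneg _) (frobNorm_nonneg _))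
    (frobNorm_nonneg _) two_ne_zero).1 ?_
  rw [mul_pow, frobNorm_sq, frobNorm_sq, Finset.mul_sum]
  refine Finset.sum_le_sum fun i _ => ?_
  have h := pow_le_pow_left₀ (mul_nonneg (sigmaMin_nonneg _) (norm_nonneg _))
    (sigmaMin_mul_norm_le M (WithLp.toLp 2 (X i))) 2
  rw [mul_pow, toEuclideanLin_norm_sq, EuclideanSpace.real_norm_sq_eq,
    Matrix.mulVec_transpose] at h
  exact h

lemma sigmaMin_le_specNorm [DecidableEq m] [DecidableEq n] [Nonempty m] (M : Matrix m n ℝ) :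
    sigmaMin M ≤ specNorm M := by
  obtain ⟨i⟩ := ‹Nonempty m›
  have h₁ := sigmaMin_mul_norm_le M (EuclideanSpace.single i 1)
  have h₂ := (LinearMap.toContinuousLinearMap (Matrix.toEuclideanLin Mᵀ)).le_opNorm
    (EuclideanSpace.single i 1)
  have h₃ : ‖LinearMap.toContinuousLinearMap (Matrix.toEuclideanLin Mᵀ)‖ = specNorm M :=
    specNorm_transpose M
  rw [h₃] at h₂
  simpa using h₁.trans h₂

lemma sigmaMin_pos_of_rank_eq [DecidableEq m] [Nonempty m] {M : Matrix m n ℝ}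
    (h : M.rank = Fintype.card m) : 0 < sigmaMin M := by
  have hinj : Function.Injective (Matrix.toEuclideanLin Mᵀ) := by
    have hli : LinearIndependent ℝ M.row := by
      rw [linearIndependent_iff_card_eq_finrank_span, ← h, M.rank_eq_finrank_span_row]
      rfl
    have hvec := Matrix.vecMul_injective_iff.2 hli
    intro x y hxy
    have hxy' : Mᵀ *ᵥ x.ofLp = Mᵀ *ᵥ y.ofLp := congrArg WithLp.ofLp hxy
    rw [Matrix.mulVec_transpose, Matrix.mulVec_transpose] at hxy'
    exact WithLp.ofLp_injective 2 (hvec hxy')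
  obtain ⟨K, hK, hK'⟩ := (Matrix.toEuclideanLin Mᵀ).exists_antilipschitzWith
    (LinearMap.ker_eq_bot.2 hinj)
  obtain ⟨i⟩ := ‹Nonempty m›
  refine lt_of_lt_of_le (b := (K : ℝ)⁻¹) (by positivity) (le_csInf ?_ ?_)
  · exact ⟨_, EuclideanSpace.single i 1, by simp, rfl⟩
  · rintro _ ⟨x, hx, rfl⟩
    have := hK'.le_mul_norm (map_zero _) x
    rw [hx] at this
    rw [inv_le_iff_one_le_mul₀ (by positivity)]
    linarith

end SpectralNorm

lemma specNorm_le_qmax {n N : Type*} [Fintype n] [Fintype N] [DecidableEq n] [DecidableEq N]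
    (Z : Matrix n N ℝ) (k : n) : specNorm (Dk k * Z * Dtil Z k) ≤ qmax Z :=
  le_ciSup (f := fun k => specNorm (Dk k * Z * Dtil Z k)) (Set.finite_range _).bddAbove k

/-- The rotation by the angle with cosine `c` and sine `s` in the coordinate plane `(i, j)`. -/
def planeRotation {n : Type*} [DecidableEq n] (i j : n) (c s : ℝ) : Matrix n n ℝ :=
  1 + (c - 1) • (Matrix.single i i 1 + Matrix.single j j 1)
    + s • (Matrix.single i j 1 - Matrix.single j i 1)

lemma planeRotation_transpose_mul_self {n : Type*} [Fintype n] [DecidableEq n] {i j : n}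
    (hij : i ≠ j) {c s : ℝ} (h : c ^ 2 + s ^ 2 = 1) :
    (planeRotation i j c s)ᵀ * planeRotation i j c s = 1 := by
  simp only [planeRotation, Matrix.transpose_add, Matrix.transpose_sub, Matrix.transpose_smul,
    Matrix.transpose_one, Matrix.transpose_single, Matrix.add_mul, Matrix.mul_add, Matrix.sub_mul,
    Matrix.mul_sub, Matrix.smul_mul, Matrix.mul_smul, Matrix.one_mul,
    Matrix.single_mul_single_same, Matrix.single_mul_single_of_ne _ _ _ _ hij,
    Matrix.single_mul_single_of_ne _ _ _ _ hij.symm, mul_one]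
  linear_combination (norm := module) h • (Matrix.single i i (1 : ℝ) + Matrix.single j j 1)

lemma transpose_eq_self_of_trace_orthogonal_mul_le {n : Type*} [Fintype n] [DecidableEq n]
    {H : Matrix n n ℝ} (hH : ∀ Q : Matrix n n ℝ, Qᵀ * Q = 1 → (Q * H).trace ≤ H.trace) :
    Hᵀ = H := by
  ext i j
  rw [Matrix.transpose_apply]
  rcases eq_or_ne i j with rfl | hij
  · rfl
  set a := H i i + H j j
  have key (t : ℝ) : t * (H j i - H i j) ≤ t ^ 2 * a := by
    have ht : 0 < 1 + t ^ 2 := by positivity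
    have h := hH _ (planeRotation_transpose_mul_self hij
      (c := (1 - t ^ 2) / (1 + t ^ 2)) (s := 2 * t / (1 + t ^ 2)) (by field_simp; ring))
    simp only [planeRotation, Matrix.add_mul, Matrix.sub_mul, Matrix.smul_mul,
      Matrix.trace_add, Matrix.trace_sub, Matrix.trace_smul, Matrix.trace_single_mul,
      smul_eq_mul, one_mul] at h
    have h' : (2 * t / (1 + t ^ 2)) * (H j i - H i j)
        ≤ (1 - (1 - t ^ 2) / (1 + t ^ 2)) * a := by linarith
    have e : 1 - (1 - t ^ 2) / (1 + t ^ 2) = 2 * t ^ 2 / (1 + t ^ 2) := by field_simp; ring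
    rw [e, div_mul_eq_mul_div, div_mul_eq_mul_div, div_le_div_iff_of_pos_right ht] at h'
    linarith
  by_contra hne
  have hb : 0 < (H j i - H i j) ^ 2 := by
    have := sub_ne_zero.2 hne
    positivity
  have ha : 0 < |a| + 1 := by positivity
  have h := key ((H j i - H i j) / (|a| + 1))
  have h' : (H j i - H i j) ^ 2 * (|a| + 1) ≤ (H j i - H i j) ^ 2 * a := by
    have := mul_le_mul_of_nonneg_right h (sq_nonneg (|a| + 1))
    field_simp at this
    linarith
  nlinarith [le_abs_self a]

lemma transpose_eq_self_of_procrustes {n p : Type*} [Fintype n] [Fintype p] [DecidableEq n]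
    {U : Matrix n n ℝ} (hU : Uᵀ * U = 1) {X Y : Matrix n p ℝ}
    (hmin : ∀ V : Matrix n n ℝ, Vᵀ * V = 1 → frobNorm (U * X - Y) ≤ frobNorm (V * X - Y)) :
    (U * X * Yᵀ)ᵀ = U * X * Yᵀ := by
  refine transpose_eq_self_of_trace_orthogonal_mul_le fun Q hQ => ?_
  have hQU : (Q * U)ᵀ * (Q * U) = 1 := by
    rw [Matrix.transpose_mul, Matrix.mul_assoc, ← Matrix.mul_assoc Qᵀ, hQ, Matrix.one_mul, hU]
  have h := pow_le_pow_left₀ (frobNorm_nonneg _) (hmin _ hQU) 2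
  rw [frobNorm_sub_sq_of_orthogonal hU, frobNorm_sub_sq_of_orthogonal hQU] at h
  simp only [Matrix.mul_assoc] at h ⊢
  linarith

lemma two_mul_sigmaMin_sq_mul_frobNorm_le {n p : Type*} [Fintype n] [Fintype p] [DecidableEq n]
    (Z : Matrix n p ℝ) (V : Matrix n n ℝ) :
    2 * sigmaMin Z ^ 2 * frobNorm V ≤ frobNorm (V * (Z * Zᵀ) + Z * Zᵀ * V) := by
  rcases (frobNorm_nonneg V).eq_or_lt with h | h
  · rw [← h, mul_zero]
    exact frobNorm_nonneg _
  have h₁ : sigmaMin Z ^ 2 * frobNorm V ^ 2 ≤ (Vᵀ * (V * (Z * Zᵀ))).trace := by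
    have := pow_le_pow_left₀ (mul_nonneg (sigmaMin_nonneg _) (frobNorm_nonneg _))
      (sigmaMin_mul_frobNorm_le V Z) 2
    rw [mul_pow, frobNorm_sq_eq_trace (V * Z)] at this
    refine this.trans_eq ?_
    rw [Matrix.transpose_mul, Matrix.mul_assoc, Matrix.trace_mul_comm]
    simp only [Matrix.mul_assoc]
  have h₂ : sigmaMin Z ^ 2 * frobNorm V ^ 2 ≤ (Vᵀ * (Z * Zᵀ * V)).trace := by
    have := pow_le_pow_left₀ (mul_nonneg (sigmaMin_nonneg _) (frobNorm_nonneg _))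
      (sigmaMin_mul_frobNorm_le Vᵀ Z) 2
    rw [mul_pow, frobNorm_transpose, ← frobNorm_transpose (Vᵀ * Z),
      frobNorm_sq_eq_trace (Vᵀ * Z)ᵀ] at this
    simpa only [Matrix.transpose_mul, Matrix.transpose_transpose, Matrix.mul_assoc] using this
  have h₃ := trace_transpose_mul_le V (V * (Z * Zᵀ) + Z * Zᵀ * V)
  rw [Matrix.mul_add, Matrix.trace_add] at h₃
  refine le_of_mul_le_mul_left ?_ h
  nlinarith

/-- The entries of `X` on the support of `Z`. -/
noncomputable def maskBy {n p : Type*} (Z X : Matrix n p ℝ) : Matrix n p ℝ :=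
  Matrix.of fun i j => if Z i j ≠ 0 then X i j else 0

lemma frobNorm_maskBy_le {n p : Type*} [Fintype n] [Fintype p] (Z X : Matrix n p ℝ) :
    frobNorm (maskBy Z X) ≤ frobNorm X := by
  refine Real.sqrt_le_sqrt (Finset.sum_le_sum fun i _ => Finset.sum_le_sum fun j _ => ?_)
  simp only [maskBy, Matrix.of_apply]
  split_ifs
  · exact le_rfl
  · simpa using sq_nonneg (X i j)

/-- Row `k` is the image of row `k` of `X` under `D_k Z D̃_k`; off the diagonal this is
`maskBy Z X * Zᵀ`. -/
noncomputable def offDiagCorrelation {n p : Type*} [Fintype n] [Fintype p] [DecidableEq n] [DecidableEq p]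
    (Z X : Matrix n p ℝ) : Matrix n n ℝ :=
  Matrix.of fun k => (Dk k * Z * Dtil Z k) *ᵥ X k

lemma offDiagCorrelation_apply {n p : Type*} [Fintype n] [Fintype p] [DecidableEq n]
    [DecidableEq p] (Z X : Matrix n p ℝ) (k l : n) :
    offDiagCorrelation Z X k l = if l = k then 0 else (maskBy Z X * Zᵀ) k l := by
  simp only [offDiagCorrelation, Dk, Dtil, Matrix.of_apply, Matrix.mulVec, dotProduct,
    Matrix.mul_diagonal, Matrix.diagonal_mul]
  rw [Matrix.mul_apply]
  simp only [maskBy, Matrix.of_apply, Matrix.transpose_apply]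
  split_ifs
  · simp
  · refine Finset.sum_congr rfl fun j _ => ?_
    split_ifs <;> ring

lemma maskBy_mul_transpose_sub_transpose {n p : Type*} [Fintype n] [Fintype p] [DecidableEq n]
    [DecidableEq p] (Z X : Matrix n p ℝ) :
    maskBy Z X * Zᵀ - (maskBy Z X * Zᵀ)ᵀ =
      offDiagCorrelation Z X - (offDiagCorrelation Z X)ᵀ := by
  ext k l
  simp only [Matrix.sub_apply, Matrix.transpose_apply (M := offDiagCorrelation Z X),
    Matrix.transpose_apply (M := maskBy Z X * Zᵀ), offDiagCorrelation_apply]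
  rcases eq_or_ne k l with rfl | h
  · simp
  · simp [h, h.symm]

lemma qmax_nonneg {n p : Type*} [Fintype n] [Fintype p] [DecidableEq n] [DecidableEq p]
    (Z : Matrix n p ℝ) : 0 ≤ qmax Z :=
  Real.iSup_nonneg fun _ => specNorm_nonneg _

lemma frobNorm_offDiagCorrelation_le {n p : Type*} [Fintype n] [Fintype p] [DecidableEq n]
    [DecidableEq p] (Z X : Matrix n p ℝ) :
    frobNorm (offDiagCorrelation Z X) ≤ qmax Z * frobNorm X := by
  refine (pow_le_pow_iff_left₀ (frobNorm_nonneg _)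
    (mul_nonneg (qmax_nonneg _) (frobNorm_nonneg _)) two_ne_zero).1 ?_
  rw [mul_pow, frobNorm_sq, frobNorm_sq, Finset.mul_sum]
  refine Finset.sum_le_sum fun k _ => (sum_mulVec_sq_le _ (X k)).trans ?_
  exact mul_le_mul_of_nonneg_right
    (pow_le_pow_left₀ (specNorm_nonneg _) (specNorm_le_qmax Z k) 2)
    (Finset.sum_nonneg fun _ _ => sq_nonneg _)

/-- For `A = Z Zᵀ` and `M = S Zᵀ`, the symmetry condition on `U = 1 + V` is a Sylvester equation
for `V` up to quadratic terms. -/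
lemma sylvester_of_procrustes {n p : Type*} [Fintype n] [Fintype p] [DecidableEq n]
    {U : Matrix n n ℝ} (hU : Uᵀ * U = 1) {Z S : Matrix n p ℝ}
    (hsymm : (U * Z * (Z + S)ᵀ)ᵀ = U * Z * (Z + S)ᵀ) :
    (U - 1) * (Z * Zᵀ) + Z * Zᵀ * (U - 1) =
      S * Zᵀ - (S * Zᵀ)ᵀ + (S * Zᵀ * (U - 1)ᵀ - (S * Zᵀ * (U - 1)ᵀ)ᵀ)
        - Z * Zᵀ * ((U - 1)ᵀ * (U - 1)) := by
  simp only [Matrix.transpose_mul, Matrix.transpose_add, Matrix.transpose_sub,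
    Matrix.transpose_transpose, Matrix.transpose_one, Matrix.mul_add,
    Matrix.mul_sub, Matrix.sub_mul, Matrix.mul_one, Matrix.one_mul, Matrix.mul_assoc, hU] at hsymm ⊢
  rw [← sub_eq_zero] at hsymm ⊢
  rw [← neg_eq_zero, ← hsymm]
  abel

lemma frobNorm_orthogonal_sub_one_le {n p : Type*} [Fintype n] [Fintype p] [DecidableEq n]
    [DecidableEq p] {Z : Matrix n p ℝ} (hZ : specNorm Z = 1) (hσ : 0 < sigmaMin Z)
    (hσ₁ : sigmaMin Z ≤ 1) {U D : Matrix n n ℝ} (hU : Uᵀ * U = 1)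
    (hmin : ∀ V : Matrix n n ℝ, Vᵀ * V = 1 →
      frobNorm (U * Z - (Z + maskBy Z (D * Z))) ≤ frobNorm (V * Z - (Z + maskBy Z (D * Z)))) :
    sigmaMin Z ^ 4 * frobNorm (U - 1) ≤ (qmax Z + 4 * frobNorm D) * frobNorm D := by
  set S := maskBy Z (D * Z)
  set σ := sigmaMin Z
  set d := frobNorm D
  set v := frobNorm (U - 1)
  have hd : 0 ≤ d := frobNorm_nonneg _
  have hv : 0 ≤ v := frobNorm_nonneg _
  have hq := qmax_nonneg Z
  have hDZ : frobNorm (D * Z) ≤ d := by simpa [hZ] using frobNorm_mul_le_specNorm D Z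
  have hS : frobNorm S ≤ d := (frobNorm_maskBy_le _ _).trans hDZ
  have hM : frobNorm (S * Zᵀ) ≤ d := by
    have := frobNorm_mul_le_specNorm S Zᵀ
    rw [specNorm_transpose, hZ, one_mul] at this
    exact this.trans hS
  have hclose : σ * v ≤ 2 * d := by
    have h₁ := hmin 1 (by simp)
    have h₂ : frobNorm ((1 : Matrix n n ℝ) * Z - (Z + S)) = frobNorm S := by
      rw [Matrix.one_mul, frobNorm_sub_comm, add_sub_cancel_left]
    have h₃ := frobNorm_add_le (U * Z - (Z + S)) S
    have h₄ : U * Z - (Z + S) + S = (U - 1) * Z := by rw [Matrix.sub_mul, Matrix.one_mul]; abel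
    rw [h₄] at h₃
    have h₅ : σ * v ≤ _ := sigmaMin_mul_frobNorm_le (U - 1) Z
    linarith
  have hskew : frobNorm (S * Zᵀ - (S * Zᵀ)ᵀ) ≤ 2 * (qmax Z * d) := by
    rw [maskBy_mul_transpose_sub_transpose]
    have h₁ := frobNorm_sub_le (offDiagCorrelation Z (D * Z)) (offDiagCorrelation Z (D * Z))ᵀ
    have h₂ := frobNorm_offDiagCorrelation_le Z (D * Z)
    have h₃ := mul_le_mul_of_nonneg_left hDZ hq
    rw [frobNorm_transpose] at h₁
    linarith
  have hcross : frobNorm (S * Zᵀ * (U - 1)ᵀ - (S * Zᵀ * (U - 1)ᵀ)ᵀ) ≤ 2 * (d * v) := by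
    have h₁ := frobNorm_sub_le (S * Zᵀ * (U - 1)ᵀ) (S * Zᵀ * (U - 1)ᵀ)ᵀ
    have h₂ := frobNorm_mul_le (S * Zᵀ) (U - 1)ᵀ
    have h₃ := mul_le_mul_of_nonneg_right hM hv
    rw [frobNorm_transpose] at h₁ h₂
    linarith
  have hquad : frobNorm (Z * Zᵀ * ((U - 1)ᵀ * (U - 1))) ≤ v * v := by
    have h₁ := frobNorm_mul_le_specNorm ((U - 1)ᵀ * (U - 1))ᵀ Z
    have h₂ := frobNorm_mul_le_specNorm (((U - 1)ᵀ * (U - 1))ᵀ * Z) Zᵀ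
    have h₃ := frobNorm_mul_le (U - 1)ᵀ (U - 1)
    rw [specNorm_transpose, hZ, one_mul, ← frobNorm_transpose] at h₂
    rw [hZ, one_mul, frobNorm_transpose] at h₁
    rw [frobNorm_transpose] at h₃
    simp only [Matrix.transpose_mul, Matrix.transpose_transpose, Matrix.mul_assoc] at h₁ h₂ h₃ ⊢
    exact h₂.trans (h₁.trans h₃)
  have hsyl := two_mul_sigmaMin_sq_mul_frobNorm_le Z (U - 1)
  rw [sylvester_of_procrustes hU (transpose_eq_self_of_procrustes hU hmin)] at hsyl
  have h₁ := frobNorm_sub_le (S * Zᵀ - (S * Zᵀ)ᵀ + (S * Zᵀ * (U - 1)ᵀ - (S * Zᵀ * (U - 1)ᵀ)ᵀ))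
    (Z * Zᵀ * ((U - 1)ᵀ * (U - 1)))
  have h₂ := frobNorm_add_le (S * Zᵀ - (S * Zᵀ)ᵀ) (S * Zᵀ * (U - 1)ᵀ - (S * Zᵀ * (U - 1)ᵀ)ᵀ)
  have hmain : 2 * σ ^ 2 * v ≤ 2 * (qmax Z * d) + 2 * (d * v) + v * v := by
    change 2 * σ ^ 2 * v ≤ _ at hsyl
    linarith
  have hσ₂ : σ ^ 2 ≤ 1 := pow_le_one₀ hσ.le hσ₁
  have e₁ : σ ^ 2 * (d * v) ≤ 2 * d ^ 2 := by
    have : σ * (σ * v) * d ≤ 1 * (2 * d) * d := by gcongr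
    linarith
  have e₂ : σ ^ 2 * (v * v) ≤ 4 * d ^ 2 := by
    have : (σ * v) ^ 2 ≤ (2 * d) ^ 2 := by gcongr
    linarith
  have e₃ : σ ^ 2 * (qmax Z * d) ≤ 1 * (qmax Z * d) := by gcongr
  have e₄ := mul_le_mul_of_nonneg_left hmain (sq_nonneg σ)
  linarith

lemma IsHardThresh.eq_of_close {n s : ℕ} {v z w : Fin n → ℝ} (hz : IsHardThresh s v z)
    (hw : (Finset.univ.filter fun i => w i ≠ 0).card = s) {b : ℝ}
    (hb : ∀ i, w i ≠ 0 → b ≤ |w i|) (hv : ∀ i, |v i - w i| < b / 2) (i : Fin n) :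
    z i = if w i ≠ 0 then v i else 0 := by
  obtain ⟨T, hT, hdom, hon, hoff⟩ := hz
  have hsupp : T = Finset.univ.filter fun i => w i ≠ 0 := by
    refine Finset.eq_of_subset_of_card_le (fun k hk => ?_) (by rw [hw, hT])
    rw [Finset.mem_filter_univ]
    intro hk₀
    obtain ⟨l, hl, hlT⟩ : ∃ l ∈ Finset.univ.filter fun i => w i ≠ 0, l ∉ T := by
      by_contra! hsub
      have := Finset.eq_of_subset_of_card_le hsub (by rw [hw, hT])
      rw [← this, Finset.mem_filter_univ] at hk
      exact hk hk₀
    have h₁ := hdom k hk l hlT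
    have h₂ := hb l (by simpa using hl)
    have h₃ := hv k
    have h₄ := hv l
    have h₅ := abs_sub_abs_le_abs_sub (w l) (v l)
    rw [hk₀, sub_zero] at h₃
    rw [abs_sub_comm] at h₅
    linarith
  split_ifs with h
  · exact hon i (by simpa [hsupp] using h)
  · exact hoff i (by simpa [hsupp] using h)

lemma exists_pos_le_abs_of_ne_zero {n p : Type*} [Finite n] [Finite p] (Z : Matrix n p ℝ) :
    ∃ b > 0, ∀ i j, Z i j ≠ 0 → b ≤ |Z i j| := by
  have hev : ∀ i j, ∀ᶠ b in nhdsWithin (0 : ℝ) (Set.Ioi 0), Z i j ≠ 0 → b ≤ |Z i j| := by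
    intro i j
    by_cases h : Z i j = 0
    · simp [h]
    · filter_upwards [Ioo_mem_nhdsGT (abs_pos.2 h)] with b hb _ using hb.2.le
  have hall := (eventually_all.2 fun i => eventually_all.2 (hev i)).and self_mem_nhdsWithin
  obtain ⟨b, hb, hb₀⟩ := hall.exists
  exact ⟨b, hb₀, hb⟩

/-- one full alternating step contracts the operator error by a factor
`q̄ ∈ (q, 1)` for small enough initialization error. -/
theorem stmt9 (n N s : ℕ) (hs : 1 ≤ s) (hsn : s ≤ n)
    (Wstar : Matrix (Fin n) (Fin n) ℝ) (Zstar P : Matrix (Fin n) (Fin N) ℝ)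
    (hWorth : Wstarᵀ * Wstar = 1)
    (hP : P = Wstarᵀ * Zstar)
    (hPnorm : specNorm P = 1)
    (hcols : ∀ j, (Finset.univ.filter (fun i => Zstar i j ≠ 0)).card = s)
    (hrank : Zstar.rank = n)
    (hq : condNum Zstar ^ 4 * qmax Zstar < 1) :
    ∀ qbar : ℝ, condNum Zstar ^ 4 * qmax Zstar < qbar → qbar < 1 →
      ∃ ε > 0, ∀ W0 : Matrix (Fin n) (Fin n) ℝ, frobNorm (W0 - Wstar) ≤ ε →
        ∀ (Z1 : Matrix (Fin n) (Fin N) ℝ) (W1 : Matrix (Fin n) (Fin n) ℝ),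
          (∀ j, IsHardThresh s (fun i => (W0 * P) i j) (fun i => Z1 i j)) →
          W1ᵀ * W1 = 1 →
          (∀ W' : Matrix (Fin n) (Fin n) ℝ, W'ᵀ * W' = 1 →
            frobNorm (W1 * P - Z1) ≤ frobNorm (W' * P - Z1)) →
          frobNorm (W1 - Wstar) ≤ qbar * frobNorm (W0 - Wstar) := by
  intro qbar hqbar _
  have hWorth' : Wstar * Wstarᵀ = 1 := mul_eq_one_comm.1 hWorth
  have hZ : Zstar = Wstar * P := by rw [hP, ← Matrix.mul_assoc, hWorth', Matrix.one_mul]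
  have hZnorm : specNorm Zstar = 1 := by rw [hZ, specNorm_eq_of_orthogonal_mul hWorth, hPnorm]
  have : Nonempty (Fin n) := ⟨⟨0, by omega⟩⟩
  have hσ : 0 < sigmaMin Zstar := sigmaMin_pos_of_rank_eq (by simpa using hrank)
  have hσ₁ : sigmaMin Zstar ≤ 1 := hZnorm ▸ sigmaMin_le_specNorm Zstar
  have hgap : 0 < sigmaMin Zstar ^ 4 * qbar - qmax Zstar := by
    rw [condNum, hZnorm, div_pow, one_pow, div_mul_eq_mul_div, one_mul,
      div_lt_iff₀ (by positivity)] at hqbar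
    linarith
  obtain ⟨b, hb, hbZ⟩ := exists_pos_le_abs_of_ne_zero Zstar
  refine ⟨min (b / 4) ((sigmaMin Zstar ^ 4 * qbar - qmax Zstar) / 4),
    lt_min (by positivity) (by positivity), fun W0 hW0 Z1 W1 hthr hW1 hmin => ?_⟩
  obtain ⟨hW0b, hW0q⟩ := le_min_iff.1 hW0
  have hright (X : Matrix (Fin n) (Fin n) ℝ) : frobNorm (X * Wstarᵀ) = frobNorm X := by
    rw [← frobNorm_transpose, Matrix.transpose_mul, Matrix.transpose_transpose,
      frobNorm_orthogonal_mul hWorth, frobNorm_transpose]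
  have hDnorm : frobNorm (W0 * Wstarᵀ - 1) = frobNorm (W0 - Wstar) := by
    rw [← hright (W0 - Wstar), Matrix.sub_mul, hWorth']
  have hUnorm : frobNorm (W1 * Wstarᵀ - 1) = frobNorm (W1 - Wstar) := by
    rw [← hright (W1 - Wstar), Matrix.sub_mul, hWorth']
  have hW0P : W0 * P = Zstar + (W0 * Wstarᵀ - 1) * Zstar := by
    rw [Matrix.sub_mul, Matrix.one_mul, add_sub_cancel, Matrix.mul_assoc, hP]
  have hZ1 : Z1 = Zstar + maskBy Zstar ((W0 * Wstarᵀ - 1) * Zstar) := by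
    ext i j
    have h := (hthr j).eq_of_close (w := fun i => Zstar i j) (hcols j)
      (fun i => hbZ i j) (fun i => ?_) i
    · simp only [h, hW0P, maskBy, Matrix.add_apply, Matrix.of_apply]
      split_ifs with h₀
      · rfl
      · simpa using (not_ne_iff.1 h₀).symm
    · have h₁ := abs_apply_le_frobNorm ((W0 * Wstarᵀ - 1) * Zstar) i j
      have h₂ := frobNorm_mul_le_specNorm (W0 * Wstarᵀ - 1) Zstar
      rw [hZnorm, one_mul, hDnorm] at h₂
      simp only [hW0P, Matrix.add_apply, add_sub_cancel_left]
      linarith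
  have hU : (W1 * Wstarᵀ)ᵀ * (W1 * Wstarᵀ) = 1 := by
    rw [Matrix.transpose_mul, Matrix.transpose_transpose, Matrix.mul_assoc,
      ← Matrix.mul_assoc W1ᵀ, hW1, Matrix.one_mul, hWorth']
  have hUmin (V : Matrix (Fin n) (Fin n) ℝ) (hV : Vᵀ * V = 1) :
      frobNorm (W1 * Wstarᵀ * Zstar - Z1) ≤ frobNorm (V * Zstar - Z1) := by
    have h := hmin (V * Wstar) (by
      rw [Matrix.transpose_mul, Matrix.mul_assoc, ← Matrix.mul_assoc Vᵀ, hV, Matrix.one_mul,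
        hWorth])
    rwa [Matrix.mul_assoc V, ← hZ, hP, ← Matrix.mul_assoc] at h
  have hstep := frobNorm_orthogonal_sub_one_le hZnorm hσ hσ₁ hU (hZ1 ▸ hUmin)
  rw [hDnorm, hUnorm] at hstep
  have hd := frobNorm_nonneg (W0 - Wstar)
  refine le_of_mul_le_mul_left (hstep.trans ?_) (pow_pos hσ 4)
  rw [← mul_assoc]
  exact mul_le_mul_of_nonneg_right (by linarith) hd
end

section
/- Let z* ∈ ℝ^n have at most s nonzero entries (1 ≤ s ≤ n) and let a ∈ ℝ^n be arbitrary. Then any z = H_s(z* + a) satisfies ‖z − z*‖_2 ≤ 2 ‖a‖_2. -/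
open Matrix MeasureTheory ProbabilityTheory Filter
open scoped Kronecker

/-- If every value of `f` on `A` is at most every value of `f` on `B`, and `A` has at most as many
elements as `B`, then the sum over `A` of the nonnegative function `f` is at most that over `B`. -/
theorem Finset.sum_le_sum_of_card_le_of_forall_le {ι : Type*} {A B : Finset ι} {f : ι → ℝ}
    (hf : ∀ i, 0 ≤ f i) (hcard : A.card ≤ B.card) (hAB : ∀ i ∈ B, ∀ j ∈ A, f j ≤ f i) :
    ∑ i ∈ A, f i ≤ ∑ i ∈ B, f i := by
  rcases B.eq_empty_or_nonempty with rfl | hB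
  · simp_all
  · obtain ⟨b, hb, hmin⟩ := B.exists_min_image f hB
    calc ∑ i ∈ A, f i ≤ A.card • f b := Finset.sum_le_card_nsmul _ _ _ (hAB b hb)
      _ ≤ B.card • f b := nsmul_le_nsmul_left (hf b) hcard
      _ ≤ ∑ i ∈ B, f i := Finset.card_nsmul_le_sum _ _ _ hmin

/-- hard thresholding a sparse vector plus arbitrary perturbation. -/
theorem stmt19 (n s : ℕ) (hs : 1 ≤ s) (hsn : s ≤ n)
    (zstar a z : Fin n → ℝ)
    (hzs : (Finset.univ.filter (fun i => zstar i ≠ 0)).card ≤ s)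
    (hz : IsHardThresh s (fun i => zstar i + a i) z) :
    l2norm (fun i => z i - zstar i) ≤ 2 * l2norm a := by
  classical
  obtain ⟨T, hT, hTmax, hzT, hzT'⟩ := hz
  set S := Finset.univ.filter (fun i => zstar i ≠ 0) with hS
  have hS_iff : ∀ i, i ∈ S ↔ zstar i ≠ 0 := by simp [hS]
  have hcard : (S \ T).card ≤ (T \ S).card :=
    Finset.card_sdiff_le_card_sdiff_iff.2 (hzs.trans hT.ge)
  have hexchange : ∑ i ∈ S \ T, (zstar i + a i) ^ 2 ≤ ∑ i ∈ T \ S, (zstar i + a i) ^ 2 :=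
    Finset.sum_le_sum_of_card_le_of_forall_le (fun i => sq_nonneg _) hcard fun i hi j hj =>
      sq_le_sq.2 (hTmax i (Finset.mem_sdiff.1 hi).1 j (Finset.mem_sdiff.1 hj).2)
  have hnoise : ∑ i ∈ T \ S, (zstar i + a i) ^ 2 ≤ ∑ i, a i ^ 2 := by
    rw [Finset.sum_congr rfl fun i hi => by
      rw [not_not.1 (mt (hS_iff i).2 (Finset.mem_sdiff.1 hi).2), zero_add]]
    exact Finset.sum_le_univ_sum_of_nonneg fun i => sq_nonneg _
  have hsplit : ∑ i, (z i - zstar i) ^ 2 ≤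
      ∑ i, (2 * a i ^ 2 + if i ∈ S \ T then 2 * (zstar i + a i) ^ 2 else 0) := by
    refine Finset.sum_le_sum fun i _ => ?_
    by_cases hiT : i ∈ T
    · simp only [Finset.mem_sdiff, hiT, hzT i hiT]
      simp only [not_true_eq_false, and_false, if_false]
      nlinarith [sq_nonneg (a i)]
    · by_cases hiS : i ∈ S
      · simp only [Finset.mem_sdiff, hiT, hiS, hzT' i hiT, not_false_eq_true, and_self, if_true]
        nlinarith [sq_nonneg (zstar i + 2 * a i)]
      · have h0 : zstar i = 0 := not_not.1 (mt (hS_iff i).2 hiS)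
        simp only [Finset.mem_sdiff, hiS, hzT' i hiT, h0, false_and, if_false]
        nlinarith [sq_nonneg (a i)]
  rw [Finset.sum_add_distrib, ← Finset.mul_sum, Finset.sum_ite_mem, Finset.univ_inter,
    ← Finset.mul_sum] at hsplit
  unfold l2norm
  refine Real.sqrt_le_iff.2 ⟨by positivity, ?_⟩
  rw [mul_pow, Real.sq_sqrt (Finset.sum_nonneg fun i _ => sq_nonneg _)]
  linarith
end
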